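/- arXiv:1606.07588 — 11 statements merged into one kernel-verified Lean document; each statement's English description precedes it below -/
import Mathlib

section
/- Let F be a field with char(F) ≠ 2, let V be a finite-dimensional F-vector space with a nondegenerate symmetric bilinear form b, and let × be a cross product on (V, b) that is not identically zero. Then dim_F V = 3 or dim_F V = 7. -/
section OrthogonalFamilies

variable {F V : Type*} [Field F] [AddCommGroup V] [Module F V]

/-- Polarization: if `z`, `w` and `z + w` are isotropic, then `z` and `w` are orthogonal. -/
theorem bilin_eq_zero_of_isotropic (h2 : (2 : F) ≠ 0) {b : V →ₗ[F] V →ₗ[F] F}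
    (hsymm : ∀ x y, b x y = b y x) {z w : V}
    (hz : b z z = 0) (hw : b w w = 0) (hzw : b (z + w) (z + w) = 0) : b z w = 0 := by
  simp only [map_add, LinearMap.add_apply, hz, hw, hsymm w z] at hzw
  exact (mul_eq_zero.1 (by linear_combination hzw : (2 : F) * b z w = 0)).resolve_left h2

/-- If every vector orthogonal to an orthogonal family of anisotropic vectors is isotropic, then
the family is a basis. -/
theorem finrank_eq_card_of_orthogonal (h2 : (2 : F) ≠ 0) {b : V →ₗ[F] V →ₗ[F] F}
    (hsymm : ∀ x y, b x y = b y x) (hnd : ∀ x, (∀ y, b x y = 0) → x = 0)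
    {ι : Type*} [Fintype ι] (v : ι → V) (hv : ∀ i, b (v i) (v i) ≠ 0)
    (ho : ∀ i j, i ≠ j → b (v i) (v j) = 0)
    (hmax : ∀ w, (∀ i, b (v i) w = 0) → b w w = 0) :
    LinearIndependent F v ∧ ⊤ ≤ Submodule.span F (Set.range v) ∧
      Module.finrank F V = Fintype.card ι := by
  classical
  have hsum : ∀ (g : ι → F) i, b (v i) (∑ j, g j • v j) = g i * b (v i) (v i) := by
    intro g i
    rw [map_sum, Finset.sum_eq_single i]
    · simp
    · intro j _ hj
      simp [ho i j hj.symm]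
    · simp
  have hli : LinearIndependent F v := by
    rw [Fintype.linearIndependent_iff]
    intro g hg i
    have h := hsum g i
    rw [hg, map_zero] at h
    exact (mul_eq_zero.1 h.symm).resolve_right (hv i)
  have hspan : ⊤ ≤ Submodule.span F (Set.range v) := by
    intro z _
    let q : V → V := fun z => ∑ j, (b (v j) z / b (v j) (v j)) • v j
    have hq : ∀ z i, b (v i) (z - q z) = 0 := by
      intro z i
      rw [map_sub, hsum, div_mul_cancel₀ _ (hv i), sub_self]
    have hz : z - q z = 0 := by
      refine hnd _ fun w => ?_
      have h1 : b (z - q z) (w - q w) = 0 :=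
        bilin_eq_zero_of_isotropic h2 hsymm (hmax _ (hq z)) (hmax _ (hq w))
          (hmax _ fun i => by rw [map_add, hq, hq, add_zero])
      have h3 : b (z - q z) (q w) = 0 := by
        change b (z - q z) (∑ j, (b (v j) w / b (v j) (v j)) • v j) = 0
        rw [map_sum]
        exact Finset.sum_eq_zero fun i _ => by rw [map_smul, hsymm (z - q z), hq, smul_zero]
      rwa [map_sub, h3, sub_zero] at h1
    rw [sub_eq_zero.1 hz]
    exact Submodule.sum_mem _ fun j _ =>
      Submodule.smul_mem _ _ (Submodule.subset_span ⟨j, rfl⟩)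
  exact ⟨hli, hspan, Module.finrank_eq_card_basis (Module.Basis.mk hli hspan)⟩

end OrthogonalFamilies

/-- `c` is a cross product for the nondegenerate symmetric bilinear form `b`. -/
structure IsCrossProduct {F V : Type*} [Field F] [AddCommGroup V] [Module F V]
    (b : V →ₗ[F] V →ₗ[F] F) (c : V →ₗ[F] V →ₗ[F] V) : Prop where
  symm : ∀ x y, b x y = b y x
  nondeg : ∀ x, (∀ y, b x y = 0) → x = 0
  orth : ∀ x y, b (c x y) x = 0
  self : ∀ x, c x x = 0
  norm : ∀ x y, b (c x y) (c x y) = b x x * b y y - b x y * b y x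

namespace IsCrossProduct

variable {F V : Type*} [Field F] [AddCommGroup V] [Module F V]
  {b : V →ₗ[F] V →ₗ[F] F} {c : V →ₗ[F] V →ₗ[F] V}

theorem swap (h : IsCrossProduct b c) (x y : V) : c x y = -c y x := by
  have := h.self (x + y)
  simp only [map_add, LinearMap.add_apply, h.self, zero_add, add_zero] at this
  rw [add_comm] at this
  exact eq_neg_of_add_eq_zero_left this

theorem triple_swap (h : IsCrossProduct b c) (x y z : V) : b (c x y) z = -b (c z y) x := by
  have := h.orth (x + z) y
  simp only [map_add, LinearMap.add_apply, h.orth] at this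
  linear_combination this

theorem triple_cyclic (h : IsCrossProduct b c) (x y z : V) : b (c x y) z = b x (c y z) := by
  rw [h.triple_swap, h.swap z y, h.symm x, map_neg, LinearMap.neg_apply, neg_neg]

theorem orth_left (h : IsCrossProduct b c) (x y : V) : b x (c x y) = 0 := by
  rw [h.symm, h.orth]

theorem orth_right (h : IsCrossProduct b c) (x y : V) : b x (c y x) = 0 := by
  rw [h.swap, map_neg, h.orth_left, neg_zero]

theorem inner_cross (h : IsCrossProduct b c) (h2 : (2 : F) ≠ 0) (x y z : V) :
    b (c x y) (c x z) = b x x * b y z - b x y * b x z := by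
  have := h.norm x (y + z)
  simp only [map_add, LinearMap.add_apply, h.norm, h.symm (c x z) (c x y), h.symm z y,
    h.symm y x, h.symm z x] at this
  apply mul_left_cancel₀ h2
  linear_combination this

theorem cross_cross_self (h : IsCrossProduct b c) (h2 : (2 : F) ≠ 0) (x y : V) :
    c x (c x y) = b x y • x - b x x • y := by
  rw [← sub_eq_zero]
  refine h.nondeg _ fun z => ?_
  have := h.inner_cross h2 x y z
  have h4 : b (c x (c x y)) z = -b (c x y) (c x z) := by
    rw [h.swap x, map_neg, LinearMap.neg_apply, h.triple_cyclic]
  simp only [map_sub, map_smul, LinearMap.sub_apply, LinearMap.smul_apply, smul_eq_mul, h4]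
  linear_combination -this

theorem cross_cross_swap (h : IsCrossProduct b c) (h2 : (2 : F) ≠ 0) {x y z : V}
    (hxy : b x y = 0) (hxz : b x z = 0) (hyz : b y z = 0) :
    c x (c y z) = -c y (c x z) := by
  have := h.cross_cross_self h2 (x + y) z
  simp only [map_add, LinearMap.add_apply, h.cross_cross_self h2, hxy, hxz, hyz, h.symm y x,
    zero_smul, zero_add, add_zero, zero_sub, add_smul] at this
  rw [eq_neg_iff_add_eq_zero, ← sub_eq_zero.2 this]
  module

theorem cross_cross_assoc (h : IsCrossProduct b c) (h2 : (2 : F) ≠ 0) {x y z : V}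
    (hxy : b x y = 0) (hxz : b x z = 0) (hyz : b y z = 0) :
    c (c x y) z = -c x (c y z) := by
  rw [h.swap, h.cross_cross_swap h2 (by rw [h.symm, hxz]) (by rw [h.symm, hyz]) hxy, h.swap z y,
    map_neg, neg_neg]

/-- There is no room for a fourth independent anisotropic generator. -/
theorem isotropic_of_orthogonal (h : IsCrossProduct b c) (h2 : (2 : F) ≠ 0) {x y u w : V}
    (hx : b x x ≠ 0) (hy : b y y ≠ 0) (hu : b u u ≠ 0)
    (hxy : b x y = 0) (hxu : b x u = 0) (hyu : b y u = 0) (hpu : b (c x y) u = 0)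
    (hxw : b x w = 0) (hyw : b y w = 0) (hpw : b (c x y) w = 0) (huw : b u w = 0)
    (hxuw : b (c x u) w = 0) (hyuw : b (c y u) w = 0) (hpuw : b (c (c x y) u) w = 0) :
    b w w = 0 := by
  have hx_uw : b x (c u w) = 0 := by rw [← h.triple_cyclic, hxuw]
  have hy_uw : b y (c u w) = 0 := by rw [← h.triple_cyclic, hyuw]
  have hx_yu : b x (c y u) = 0 := by rw [← h.triple_cyclic, hpu]
  have e1 : c (c x y) (c u w) = -c x (c y (c u w)) := h.cross_cross_assoc h2 hxy hx_uw hy_uw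
  have e2 : c (c x y) (c u w) = c x (c y (c u w)) := by
    have e3 := h.cross_cross_assoc h2 hpu hpw huw
    rw [h.cross_cross_assoc h2 hxy hxu hyu, map_neg, LinearMap.neg_apply,
      h.cross_cross_assoc h2 hx_yu hxw hyuw, h.cross_cross_assoc h2 hyu hyw huw, map_neg,
      neg_neg, neg_inj] at e3
    exact e3.symm
  have e0 : c (c x y) (c u w) = 0 := by
    have : (2 : F) • c (c x y) (c u w) = 0 := by
      rw [two_smul]
      nth_rewrite 1 [e1]
      rw [e2, neg_add_cancel]
    exact (smul_eq_zero.1 this).resolve_left h2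
  have e4 := h.norm (c x y) (c u w)
  rw [e0, ← h.triple_cyclic (c x y) u w, hpuw, h.norm, h.norm, hxy, huw] at e4
  simpa [hx, hy, hu] using e4

theorem finrank_eq [FiniteDimensional F V] (h : IsCrossProduct b c) (h2 : (2 : F) ≠ 0)
    (hc : c ≠ 0) : Module.finrank F V = 3 ∨ Module.finrank F V = 7 := by
  obtain ⟨x, hx⟩ : ∃ x, b x x ≠ 0 := by
    by_contra! hb
    refine hc (LinearMap.ext fun x => ?_)
    rw [h.nondeg x fun y => bilin_eq_zero_of_isotropic h2 h.symm (hb _) (hb _) (hb _), map_zero,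
      map_zero]
  obtain ⟨y, hxy, hy⟩ : ∃ y, b x y = 0 ∧ b y y ≠ 0 := by
    by_contra! hb
    obtain ⟨-, hspan, -⟩ := finrank_eq_card_of_orthogonal h2 h.symm h.nondeg (fun _ : Unit => x)
      (fun _ => hx) (fun i j hij => (hij rfl).elim) (fun w hw => hb w (hw ()))
    have hspan' : ∀ z, ∃ a : F, a • x = z := fun z => by
      have := hspan (Submodule.mem_top (x := z))
      rwa [Set.range_const, Submodule.mem_span_singleton] at this
    refine hc (LinearMap.ext₂ fun z w => ?_)
    obtain ⟨a, rfl⟩ := hspan' z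
    obtain ⟨a', rfl⟩ := hspan' w
    simp [h.self]
  have hp : b (c x y) (c x y) ≠ 0 := by simp [h.norm, hxy, hx, hy]
  by_cases hb : ∃ u, b x u = 0 ∧ b y u = 0 ∧ b (c x y) u = 0 ∧ b u u ≠ 0
  · obtain ⟨u, hxu, hyu, hpu, hu⟩ := hb
    right
    have hxp : b x (c x y) = 0 := h.orth_left x y
    have hyp : b y (c x y) = 0 := h.orth_right y x
    have hx_yu : b x (c y u) = 0 := by rw [← h.triple_cyclic, hpu]
    have hy_xu : b y (c x u) = 0 := by
      rw [← h.triple_cyclic, h.swap, map_neg, LinearMap.neg_apply, hpu, neg_zero]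
    have hx_pu : b x (c (c x y) u) = 0 := by
      rw [← h.triple_cyclic, h.cross_cross_self h2]
      simp [hxu, hyu]
    have hy_pu : b y (c (c x y) u) = 0 := by
      rw [← h.triple_cyclic, h.swap x y, map_neg, h.cross_cross_self h2]
      simp [hxu, hyu]
    have hp_xu : b (c x y) (c x u) = 0 := by rw [h.inner_cross h2, hyu, hxy]; ring
    have hp_yu : b (c x y) (c y u) = 0 := by
      rw [h.swap x y, map_neg, LinearMap.neg_apply, h.inner_cross h2, hxu, hyu]; ring
    have key : ∀ s t, b s t = 0 → b s u = 0 → b (c s u) (c t u) = 0 := fun s t hst hsu => by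
      rw [h.swap s u, h.swap t u, map_neg, map_neg, LinearMap.neg_apply, neg_neg,
        h.inner_cross h2, hst, h.symm u s, hsu]
      ring
    have hn : ∀ s, b s s ≠ 0 → b s u = 0 → b (c s u) (c s u) ≠ 0 := fun s hs hsu => by
      simp [h.norm, hsu, hs, hu]
    let v : Fin 7 → V := ![x, y, c x y, u, c x u, c y u, c (c x y) u]
    have hlt : ∀ i j, i < j → b (v i) (v j) = 0 := by
      intro i j hij
      fin_cases i <;> fin_cases j <;> first
        | exact absurd hij (by decide)
        | simp [v, hxy, hxp, hyp, hxu, hyu, hpu, hx_yu, hy_xu, hx_pu, hy_pu, hp_xu, hp_yu,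
            h.orth_left, h.orth_right, key]
    refine (finrank_eq_card_of_orthogonal h2 h.symm h.nondeg v ?_ ?_ ?_).2.2
    · intro i
      fin_cases i
      exacts [hx, hy, hp, hu, hn x hx hxu, hn y hy hyu, hn _ hp hpu]
    · intro i j hij
      rcases hij.lt_or_gt with hij | hij
      · exact hlt i j hij
      · rw [h.symm, hlt j i hij]
    · intro w hw
      exact h.isotropic_of_orthogonal h2 hx hy hu hxy hxu hyu hpu
        (hw 0) (hw 1) (hw 2) (hw 3) (hw 4) (hw 5) (hw 6)
  · push Not at hb
    left
    let v : Fin 3 → V := ![x, y, c x y]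
    have hlt : ∀ i j, i < j → b (v i) (v j) = 0 := by
      intro i j hij
      fin_cases i <;> fin_cases j <;> first
        | exact absurd hij (by decide)
        | simp [v, hxy, h.orth_left, h.orth_right]
    refine (finrank_eq_card_of_orthogonal h2 h.symm h.nondeg v ?_ ?_ ?_).2.2
    · intro i
      fin_cases i
      exacts [hx, hy, hp]
    · intro i j hij
      rcases hij.lt_or_gt with hij | hij
      · exact hlt i j hij
      · rw [h.symm, hlt j i hij]
    · exact fun w hw => hb w (hw 0) (hw 1) (hw 2)

end IsCrossProduct

/-- An algebra with a nonzero cross product has dimension 3 or 7. -/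
theorem cross_product_dim_three_or_seven
    (F V : Type*) [Field F] [AddCommGroup V] [Module F V] [FiniteDimensional F V]
    (hchar : ringChar F ≠ 2)
    (b : V →ₗ[F] V →ₗ[F] F)
    (hsymm : ∀ x y : V, b x y = b y x)
    (hnd : ∀ x : V, (∀ y : V, b x y = 0) → x = 0)
    (c : V →ₗ[F] V →ₗ[F] V)
    (h1 : ∀ x y : V, b (c x y) x = 0)
    (h2 : ∀ x : V, c x x = 0)
    (h3 : ∀ x y : V, b (c x y) (c x y) = b x x * b y y - b x y * b y x)
    (hne : c ≠ 0) :
    Module.finrank F V = 3 ∨ Module.finrank F V = 7 := by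
  exact IsCrossProduct.finrank_eq ⟨hsymm, hnd, h1, h2, h3⟩ (Ring.two_ne_zero hchar) hne
end

section
/- Let F be a field with char(F) ≠ 2, V an F-vector space, b : V × V → F a nondegenerate symmetric bilinear form, and × : V × V → V a bilinear map. Then × is a cross product on (V, b) if and only if for all x, y, z, t ∈ V the following three identities hold: (1) b(x×y, z) = b(x, y×z); (2) x×y = −y×x; (3) b(x×y, z×t) + b(y×z, t×x) = 2·b(x,z)·b(y,t) − b(x,y)·b(z,t) − b(y,z)·b(x,t). -/
/-- Characterization of cross products via three identities. -/
theorem cross_product_iff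
    (F V : Type*) [Field F] [AddCommGroup V] [Module F V]
    (hchar : ringChar F ≠ 2)
    (b : V →ₗ[F] V →ₗ[F] F)
    (hsymm : ∀ x y : V, b x y = b y x)
    (hnd : ∀ x : V, (∀ y : V, b x y = 0) → x = 0)
    (c : V →ₗ[F] V →ₗ[F] V) :
    ((∀ x y : V, b (c x y) x = 0) ∧ (∀ x : V, c x x = 0) ∧
      (∀ x y : V, b (c x y) (c x y) = b x x * b y y - b x y * b y x))
    ↔ ((∀ x y z : V, b (c x y) z = b x (c y z)) ∧
        (∀ x y : V, c x y = - c y x) ∧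
        (∀ x y z t : V, b (c x y) (c z t) + b (c y z) (c t x)
          = 2 * (b x z * b y t) - b x y * b z t - b y z * b x t)) := by
  have h2 : (2 : F) ≠ 0 := Ring.two_ne_zero hchar
  constructor
  · rintro ⟨horth, halt, hnorm⟩
    have hskew : ∀ x y : V, c x y = - c y x := fun x y => by
      have h := halt (x + y)
      simp only [map_add, LinearMap.add_apply, halt, zero_add, add_zero] at h
      exact eq_neg_of_add_eq_zero_right h
    refine ⟨fun x y z => ?_, hskew, fun x y z t => ?_⟩
    · have h := horth (x + z) y
      simp only [map_add, LinearMap.add_apply, horth, zero_add, add_zero] at h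
      rw [hskew z y, map_neg, LinearMap.neg_apply, hsymm (c y z) x] at h
      linear_combination h
    · have hN := hnorm (x + z) (y + t)
      have hxz_y := hnorm (x + z) y
      have hxz_t := hnorm (x + z) t
      have hx_yt := hnorm x (y + t)
      have hz_yt := hnorm z (y + t)
      simp only [map_add, LinearMap.add_apply] at hN hxz_y hxz_t hx_yt hz_yt
      have hzy : b (c y z) (c t x) = b (c x t) (c z y) := by
        rw [hskew y z, hskew t x, hsymm]
        simp
      rw [hzy]
      apply mul_left_cancel₀ h2
      have hxy := hnorm x y
      have hxt := hnorm x t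
      have hzy' := hnorm z y
      have hzt := hnorm z t
      simp only [hsymm z x, hsymm t y, hsymm y x, hsymm t z, hsymm z y, hsymm t x] at hN hxz_y hxz_t hx_yt hz_yt hxy hxt hzy' hzt ⊢
      linear_combination hN - hxz_y - hxz_t - hx_yt - hz_yt + hxy + hxt + hzy' + hzt
        + hsymm (c x y) (c z t) + hsymm (c x t) (c z y)
  · rintro ⟨hassoc, hskew, hpol⟩
    have halt : ∀ x : V, c x x = 0 := fun x => by
      have h : (2 : F) • c x x = 0 := by
        rw [two_smul]
        exact add_eq_zero_iff_eq_neg.mpr (hskew x x)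
      exact (smul_eq_zero.mp h).resolve_left h2
    refine ⟨fun x y => ?_, halt, fun x y => ?_⟩
    · rw [hsymm, ← hassoc, halt, map_zero, LinearMap.zero_apply]
    · have h := hpol x y x y
      simp only [hskew y x, map_neg, LinearMap.neg_apply, neg_neg] at h
      apply mul_left_cancel₀ h2
      rw [hsymm y x] at h ⊢
      linear_combination h
end

section
/- Let F be a field with char(F) ≠ 2, V an F-vector space, b : V × V → F a nondegenerate symmetric bilinear form, and × : V × V → V a bilinear map that is anticommutative (x×y = −y×x for all x, y) and satisfies b(x×y, z) = b(x, y×z) for all x, y, z. Then the identity b(x×y, x×y) = b(x,x)·b(y,y) − b(x,y)·b(y,x) holds for all x, y ∈ V if and only if the identity (x×y)×z + x×(y×z) = 2·b(x,z)·y − b(x,y)·z − b(y,z)·x holds for all x, y, z ∈ V. -/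
/-- For an anticommutative bilinear product with associative form `b`, the norm identity
for a cross product is equivalent to the composition identity. -/
theorem cross_product_norm_iff_composition
    (F V : Type*) [Field F] [AddCommGroup V] [Module F V]
    (hchar : ringChar F ≠ 2)
    (b : V →ₗ[F] V →ₗ[F] F)
    (hsymm : ∀ x y : V, b x y = b y x)
    (hnd : ∀ x : V, (∀ y : V, b x y = 0) → x = 0)
    (c : V →ₗ[F] V →ₗ[F] V)
    (hanti : ∀ x y : V, c x y = - c y x)
    (hassoc : ∀ x y z : V, b (c x y) z = b x (c y z)) :
    (∀ x y : V, b (c x y) (c x y) = b x x * b y y - b x y * b y x)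
    ↔ (∀ x y z : V, c (c x y) z + c x (c y z)
        = (2 * b x z) • y - (b x y) • z - (b y z) • x) := by
  have h2 : (2 : F) ≠ 0 := Ring.two_ne_zero hchar
  constructor
  · intro h
    have polar (x y w : V) : b (c x y) (c x w) = b x x * b y w - b x y * b x w := by
      have e := h x (y + w)
      simp only [map_add, LinearMap.add_apply] at e
      apply mul_left_cancel₀ h2
      linear_combination e - h x y - h x w - hsymm (c x w) (c x y) + b x x * hsymm w y
        - (b x y + b x w) * (hsymm y x + hsymm w x) + b x y * hsymm y x + b x w * hsymm w x
    intro x y z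
    rw [← sub_eq_zero]
    refine hnd _ fun w => ?_
    have e := polar (x + z) y w
    simp only [map_add, LinearMap.add_apply] at e
    have e₁ : b (c (c x y) z) w = b (c x y) (c z w) := hassoc _ _ _
    have e₂ : b (c x (c y z)) w = b (c z y) (c x w) := by
      rw [hsymm, ← hassoc, hanti w x, hanti y z, hsymm]
      simp
    simp only [map_add, map_sub, map_smul, LinearMap.add_apply, LinearMap.sub_apply,
      LinearMap.smul_apply, smul_eq_mul, e₁, e₂]
    linear_combination e - polar x y w - polar z y w + b y w * hsymm z x
      + b x w * hsymm y z
  · intro h x y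
    have hself : c y y = 0 := by
      have e : (2 : F) • c y y = 0 := by
        rw [two_smul]
        exact add_eq_zero_iff_eq_neg.mpr (hanti y y)
      exact (smul_eq_zero.mp e).resolve_left h2
    have e := congrArg (b x) (h y y x)
    simp only [hself, map_zero, LinearMap.zero_apply, zero_add, map_sub, map_smul,
      smul_eq_mul] at e
    rw [hassoc, hanti x y, map_neg, map_neg, e, hsymm y x]
    ring
end

section
/- Let F be a field with char(F) ≠ 2, V a finite-dimensional F-vector space with a nondegenerate symmetric bilinear form b, and × a cross product on (V, b) that is not identically zero. If φ : V → V is a bijective F-linear map satisfying φ(x×y) = φ(x)×φ(y) for all x, y ∈ V, then b(φ(x), φ(y)) = b(x, y) for all x, y ∈ V; that is, every automorphism of (V, ×) is an isometry of (V, b). -/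
section CrossProduct

variable {F V : Type*} [Field F] [AddCommGroup V] [Module F V]
  {b : V →ₗ[F] V →ₗ[F] F} {c : V →ₗ[F] V →ₗ[F] V}

/-- The double cross product formula `x × (x × y) = b(x, y) x - b(x, x) y`. -/
theorem cross_cross_self_left (h2F : (2 : F) ≠ 0)
    (hsymm : ∀ x y : V, b x y = b y x)
    (hnd : ∀ x : V, (∀ y : V, b x y = 0) → x = 0)
    (h1 : ∀ x y : V, b (c x y) x = 0)
    (h2 : ∀ x : V, c x x = 0)
    (h3 : ∀ x y : V, b (c x y) (c x y) = b x x * b y y - b x y * b y x)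
    (x y : V) : c x (c x y) = b x y • x - b x x • y := by
  have hskew (u v : V) : c u v = -c v u := by
    have h := h2 (u + v)
    simp only [map_add, LinearMap.add_apply, h2, zero_add, add_zero] at h
    exact eq_neg_of_add_eq_zero_right h
  have hswap (u v w : V) : b (c u v) w = -b (c w v) u := by
    have h := h1 (u + w) v
    simp only [map_add, LinearMap.add_apply, h1, zero_add, add_zero] at h
    linear_combination h
  have hpolar (z : V) : b (c x y) (c x z) = b x x * b y z - b x y * b x z := by
    have h := h3 x (y + z)
    simp only [map_add, LinearMap.add_apply, h3] at h
    apply mul_left_cancel₀ h2F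
    linear_combination h - hsymm (c x z) (c x y) + b x x * hsymm z y
      - b x y * hsymm z x - b x z * hsymm y x
  refine sub_eq_zero.mp (hnd _ fun z => ?_)
  have hdouble : b (c x (c x y)) z = -b (c x y) (c x z) := by
    rw [hswap, hskew z, map_neg, LinearMap.neg_apply, neg_neg, hswap, hsymm]
  simp only [map_sub, map_smul, LinearMap.sub_apply, LinearMap.smul_apply, smul_eq_mul]
  linear_combination hdouble - hpolar z

/-- If `c` is nonzero and alternating, every vector `x` admits a `y` outside its span. -/
theorem exists_notMem_span_singleton_of_alternating (h2 : ∀ x : V, c x x = 0) (hne : c ≠ 0)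
    (x : V) : ∃ y : V, y ∉ Submodule.span F {x} := by
  by_contra! h
  refine hne (LinearMap.ext₂ fun u v => ?_)
  obtain ⟨r, rfl⟩ := Submodule.mem_span_singleton.mp (h u)
  obtain ⟨s, rfl⟩ := Submodule.mem_span_singleton.mp (h v)
  simp [h2]

end CrossProduct


/-- Every automorphism of a nonzero cross product algebra is an isometry of the form. -/
theorem cross_product_automorphism_isometry
    (F V : Type*) [Field F] [AddCommGroup V] [Module F V] [FiniteDimensional F V]
    (hchar : ringChar F ≠ 2)
    (b : V →ₗ[F] V →ₗ[F] F)
    (hsymm : ∀ x y : V, b x y = b y x)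
    (hnd : ∀ x : V, (∀ y : V, b x y = 0) → x = 0)
    (c : V →ₗ[F] V →ₗ[F] V)
    (h1 : ∀ x y : V, b (c x y) x = 0)
    (h2 : ∀ x : V, c x x = 0)
    (h3 : ∀ x y : V, b (c x y) (c x y) = b x x * b y y - b x y * b y x)
    (hne : c ≠ 0)
    (φ : V →ₗ[F] V) (hbij : Function.Bijective φ)
    (hmul : ∀ x y : V, φ (c x y) = c (φ x) (φ y)) :
    ∀ x y : V, b (φ x) (φ y) = b x y := by
  have h2F : (2 : F) ≠ 0 := Ring.two_ne_zero hchar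
  have hcc := cross_cross_self_left h2F hsymm hnd h1 h2 h3
  have hquad (x : V) : b (φ x) (φ x) = b x x := by
    obtain ⟨y, hy⟩ := exists_notMem_span_singleton_of_alternating h2 hne x
    by_contra hx
    have h := congrArg φ (hcc x y)
    rw [hmul, hmul, hcc] at h
    have key : φ ((b (φ x) (φ x) - b x x) • y) = φ ((b (φ x) (φ y) - b x y) • x) := by
      simp only [map_sub, map_smul] at h ⊢
      linear_combination (norm := module) -h
    refine hy ((Submodule.smul_mem_iff _ (sub_ne_zero.mpr hx)).mp ?_)
    rw [hbij.injective key]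
    exact Submodule.smul_mem _ _ (Submodule.mem_span_singleton_self x)
  intro x y
  have h := hquad (x + y)
  simp only [map_add, LinearMap.add_apply, hquad] at h
  apply mul_left_cancel₀ h2F
  linear_combination h - hsymm (φ y) (φ x) + hsymm y x
end

section
/- Let F be a field with char(F) ≠ 2, V an F-vector space with a nondegenerate symmetric bilinear form b, and × a cross product on (V, b). Then for all x, y, z ∈ V: (y×z)×x = (x×y)×z + b(x,y)·z − 2·b(x,z)·y + b(y,z)·x. -/
/-- A cross product applied twice: `x×(x×y) = b(x,y)x − b(x,x)y`. -/
theorem cross_self_cross {F V : Type*} [Field F] [AddCommGroup V] [Module F V]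
    (h_two : (2 : F) ≠ 0)
    (b : V →ₗ[F] V →ₗ[F] F)
    (hsymm : ∀ x y : V, b x y = b y x)
    (hnd : ∀ x : V, (∀ y : V, b x y = 0) → x = 0)
    (c : V →ₗ[F] V →ₗ[F] V)
    (hanti : ∀ x y : V, c x y = -c y x)
    (h1 : ∀ x y : V, b (c x y) x = 0)
    (h3 : ∀ x y : V, b (c x y) (c x y) = b x x * b y y - b x y * b y x)
    (x y : V) : c x (c x y) = b x y • x - b x x • y := by
  rw [← sub_eq_zero]
  refine hnd _ fun w => ?_
  have h_skew : b (c x (c x y)) w = -b (c x w) (c x y) := by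
    have hr : ∀ u, b (c x u) u = 0 := fun u => by
      rw [hanti, map_neg, LinearMap.neg_apply, h1, neg_zero]
    have h := hr (c x y + w)
    simp only [map_add, LinearMap.add_apply, hr] at h
    linear_combination h
  have h_polar := h3 x (y + w)
  simp only [map_add, LinearMap.add_apply] at h_polar
  have hy := h3 x y
  have hw := h3 x w
  simp only [map_sub, map_smul, LinearMap.sub_apply, LinearMap.smul_apply, smul_eq_mul, h_skew]
  refine mul_left_cancel₀ h_two ?_
  rw [hsymm (c x y) (c x w), hsymm y x, hsymm w x, hsymm w y] at h_polar
  rw [hsymm y x] at hy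
  rw [hsymm w x] at hw
  linear_combination -h_polar + hy + hw

/-- An identity satisfied by any cross product:
`(y×z)×x = (x×y)×z + b(x,y)z − 2b(x,z)y + b(y,z)x`. -/
theorem cross_product_rotation_identity
    (F V : Type*) [Field F] [AddCommGroup V] [Module F V]
    (hchar : ringChar F ≠ 2)
    (b : V →ₗ[F] V →ₗ[F] F)
    (hsymm : ∀ x y : V, b x y = b y x)
    (hnd : ∀ x : V, (∀ y : V, b x y = 0) → x = 0)
    (c : V →ₗ[F] V →ₗ[F] V)
    (h1 : ∀ x y : V, b (c x y) x = 0)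
    (h2 : ∀ x : V, c x x = 0)
    (h3 : ∀ x y : V, b (c x y) (c x y) = b x x * b y y - b x y * b y x) :
    ∀ x y z : V, c (c y z) x
      = c (c x y) z + (b x y) • z - (2 * b x z) • y + (b y z) • x := by
  intro x y z
  have hanti : ∀ x y : V, c x y = -c y x := fun x y => by
    have h := h2 (x + y)
    simp only [map_add, LinearMap.add_apply, h2, zero_add, add_zero] at h
    exact eq_neg_of_add_eq_zero_right h
  have hcc := cross_self_cross (Ring.two_ne_zero hchar) b hsymm hnd c hanti h1 h3
  have h := hcc (x + z) y
  simp only [map_add, LinearMap.add_apply, hcc] at h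
  rw [hanti (c y z) x, hanti y z, hanti (c x y) z, map_neg, neg_neg, hsymm y z]
  rw [hsymm z x] at h
  linear_combination (norm := module) h
end

section
/- Let F be a field with char(F) ≠ 2, V an F-vector space with a nondegenerate symmetric bilinear form b, and × a cross product on (V, b). Then for all x, y, z, t ∈ V: b(x×y, z×t) + b(y×z, x×t) + b(z×x, y×t) = 3·( b((x×y)×z, t) − b(x,z)·b(y,t) + b(y,z)·b(x,t) ). -/
/-- Polarization of the norm identity of a cross product in its second argument. -/
theorem cross_product_polarize_right
    {F V : Type*} [Field F] [AddCommGroup V] [Module F V] (htwo : (2 : F) ≠ 0)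
    (b : V →ₗ[F] V →ₗ[F] F) (hsymm : ∀ x y : V, b x y = b y x)
    (c : V →ₗ[F] V →ₗ[F] V)
    (hnorm : ∀ x y : V, b (c x y) (c x y) = b x x * b y y - b x y * b y x) (x y z : V) :
    b (c x y) (c x z) = b x x * b y z - b x y * b x z := by
  have h := hnorm x (y + z)
  simp only [map_add, LinearMap.add_apply, hnorm, hsymm (c x z) (c x y), hsymm z y,
    hsymm y x, hsymm z x] at h
  apply mul_left_cancel₀ htwo
  linear_combination h

/-- Polarization of the norm identity of a cross product in both arguments. -/
theorem cross_product_polarize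
    {F V : Type*} [Field F] [AddCommGroup V] [Module F V] (htwo : (2 : F) ≠ 0)
    (b : V →ₗ[F] V →ₗ[F] F) (hsymm : ∀ x y : V, b x y = b y x)
    (c : V →ₗ[F] V →ₗ[F] V)
    (hnorm : ∀ x y : V, b (c x y) (c x y) = b x x * b y y - b x y * b y x) (x w y z : V) :
    b (c x y) (c w z) + b (c w y) (c x z) =
      2 * b x w * b y z - b x y * b w z - b w y * b x z := by
  have hpol := cross_product_polarize_right htwo b hsymm c hnorm
  have h := hpol (x + w) y z
  simp only [map_add, LinearMap.add_apply, hpol, hsymm w x] at h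
  linear_combination h

/-- An identity satisfied by any cross product:
`b(x×y,z×t) + b(y×z,x×t) + b(z×x,y×t) = 3(b((x×y)×z,t) − b(x,z)b(y,t) + b(y,z)b(x,t))`. -/
theorem cross_product_cyclic_identity
    (F V : Type*) [Field F] [AddCommGroup V] [Module F V]
    (hchar : ringChar F ≠ 2)
    (b : V →ₗ[F] V →ₗ[F] F)
    (hsymm : ∀ x y : V, b x y = b y x)
    (hnd : ∀ x : V, (∀ y : V, b x y = 0) → x = 0)
    (c : V →ₗ[F] V →ₗ[F] V)
    (h1 : ∀ x y : V, b (c x y) x = 0)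
    (h2 : ∀ x : V, c x x = 0)
    (h3 : ∀ x y : V, b (c x y) (c x y) = b x x * b y y - b x y * b y x) :
    ∀ x y z t : V, b (c x y) (c z t) + b (c y z) (c x t) + b (c z x) (c y t)
      = 3 * (b (c (c x y) z) t - b x z * b y t + b y z * b x t) := by
  have htwo : (2 : F) ≠ 0 := Ring.two_ne_zero hchar
  have hskew (x y : V) : c y x = -c x y := by
    have h := h2 (x + y)
    simp only [map_add, LinearMap.add_apply, h2, zero_add, add_zero] at h
    exact eq_neg_of_add_eq_zero_left h
  have htriple (u z t : V) : b (c u z) t = b u (c z t) := by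
    have h := h1 (u + t) z
    simp only [map_add, LinearMap.add_apply, h1, zero_add, add_zero] at h
    rw [hsymm (c t z) u] at h
    rw [hskew t z, map_neg]
    linear_combination h
  intro x y z t
  have hzx := cross_product_polarize htwo b hsymm c h3 z x y t
  have hzy := cross_product_polarize htwo b hsymm c h3 z y x t
  rw [hskew y z, map_neg, LinearMap.neg_apply] at hzx
  rw [hskew x y, map_neg, LinearMap.neg_apply] at hzy
  rw [htriple (c x y) z t, hsymm y z, hsymm x z]
  rw [hsymm y x] at hzy
  linear_combination hzy - hzx
end

section
/- Let F be a field with char(F) ≠ 2, V an F-vector space with a nondegenerate symmetric bilinear form b, and × a cross product on (V, b). Then for all x₁, x₂, x₃, x₄ ∈ V, the complete skew symmetrization over the symmetric group S₄ satisfies: Σ_{σ ∈ S₄} sgn(σ) · b(x_{σ(1)}×x_{σ(2)}, x_{σ(3)}×x_{σ(4)}) = 24·( b((x₁×x₂)×x₃, x₄) − b(x₁,x₃)·b(x₂,x₄) + b(x₁,x₄)·b(x₂,x₃) ). -/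
/-- Expansion of a signed sum over `S₄` when the summand, as a function of four indices, is
antisymmetric in the first two and symmetric under exchange of the first pair with the second. -/
theorem sum_perm_fin_four_sign_mul {R : Type*} [CommRing R]
    (A : Fin 4 → Fin 4 → Fin 4 → Fin 4 → R)
    (hl : ∀ i j k l, A i j k l = -A j i k l)
    (hs : ∀ i j k l, A i j k l = A k l i j) :
    ∑ σ : Equiv.Perm (Fin 4), ((Equiv.Perm.sign σ : ℤ) : R) * A (σ 0) (σ 1) (σ 2) (σ 3)
      = 8 * (A 0 1 2 3 - A 0 2 1 3 + A 0 3 1 2) := by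
  have hr : ∀ i j k l, A i j k l = -A i j l k := fun i j k l => by rw [hs, hl, hs]
  have one_eq : (1 : Fin 4) = Fin.succ 0 := rfl
  have two_eq : (2 : Fin 4) = Fin.succ (Fin.succ 0) := rfl
  have three_eq : (3 : Fin 4) = Fin.succ (Fin.succ (Fin.succ 0)) := rfl
  rw [one_eq, two_eq, three_eq]
  simp only [Finset.univ_perm_fin_succ, Finset.sum_map, ← Finset.univ_product_univ,
    Finset.sum_product, Fin.sum_univ_succ, Equiv.toEmbedding_apply,
    Equiv.Perm.decomposeFin_symm_apply_succ, Equiv.Perm.decomposeFin_symm_apply_zero,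
    Equiv.Perm.decomposeFin.symm_sign]
  simp [Equiv.swap_apply_def, Fin.ext_iff]
  grind

/-- The complete skew symmetrization over `S₄` of `b(x₁×x₂, x₃×x₄)`. -/
theorem cross_product_skew_symmetrization
    (F V : Type*) [Field F] [AddCommGroup V] [Module F V]
    (hchar : ringChar F ≠ 2)
    (b : V →ₗ[F] V →ₗ[F] F)
    (hsymm : ∀ x y : V, b x y = b y x)
    (hnd : ∀ x : V, (∀ y : V, b x y = 0) → x = 0)
    (c : V →ₗ[F] V →ₗ[F] V)
    (h1 : ∀ x y : V, b (c x y) x = 0)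
    (h2 : ∀ x : V, c x x = 0)
    (h3 : ∀ x y : V, b (c x y) (c x y) = b x x * b y y - b x y * b y x)
    (x : Fin 4 → V) :
    ∑ σ : Equiv.Perm (Fin 4),
        ((Equiv.Perm.sign σ : ℤ) : F) *
          b (c (x (σ 0)) (x (σ 1))) (c (x (σ 2)) (x (σ 3)))
      = 24 * (b (c (c (x 0) (x 1)) (x 2)) (x 3)
          - b (x 0) (x 2) * b (x 1) (x 3) + b (x 0) (x 3) * b (x 1) (x 2)) := by
  have two_ne : (2 : F) ≠ 0 := Ring.two_ne_zero hchar
  have c_skew (u v : V) : c u v = -c v u := by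
    have h := h2 (u + v)
    simp only [map_add, LinearMap.add_apply, h2, zero_add, add_zero] at h
    exact eq_neg_of_add_eq_zero_right h
  have triple_skew (u v w : V) : b (c u v) w = -b (c w v) u := by
    have h := h1 (u + w) v
    simp only [map_add, LinearMap.add_apply, h1, zero_add, add_zero] at h
    exact eq_neg_of_add_eq_zero_right h
  have triple_cyclic (u v w : V) : b (c u v) w = b u (c v w) := by
    rw [triple_skew, c_skew w v, map_neg, LinearMap.neg_apply, neg_neg, hsymm]
  have polar_right (u v w : V) :
      b (c u v) (c u w) = b u u * b v w - b u v * b u w := by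
    have h := h3 u (v + w)
    simp only [map_add, LinearMap.add_apply, h3] at h
    rw [hsymm (c u w) (c u v), hsymm w v, hsymm v u, hsymm w u] at h
    exact mul_left_cancel₀ two_ne (by linear_combination h)
  have polar (u v w z : V) :
      b (c u v) (c w z) + b (c w v) (c u z)
        = 2 * (b u w * b v z) - b u v * b w z - b w v * b u z := by
    have h := polar_right (u + w) v z
    simp only [map_add, LinearMap.add_apply, polar_right] at h
    rw [hsymm w u] at h
    linear_combination h
  have skew_left (u v w z : V) : b (c u v) (c w z) = -b (c v u) (c w z) := by
    rw [c_skew u v, map_neg, LinearMap.neg_apply]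
  rw [sum_perm_fin_four_sign_mul (fun i j k l => b (c (x i) (x j)) (c (x k) (x l)))
    (fun i j k l => skew_left _ _ _ _) (fun i j k l => hsymm _ _), triple_cyclic (c (x 0) (x 1))]
  have p := polar (x 0) (x 1) (x 2) (x 3)
  have q := polar (x 0) (x 1) (x 3) (x 2)
  rw [skew_left (x 2), hsymm (c (x 1) (x 2)), hsymm (x 2) (x 1)] at p
  rw [c_skew (x 3) (x 2), skew_left (x 3), hsymm (c (x 1) (x 3)), hsymm (x 3) (x 2),
    hsymm (x 3) (x 1), map_neg] at q
  linear_combination -8 * p + 8 * q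
end

section
/- Let F be a field with char(F) ≠ 2, V an F-vector space with a nondegenerate symmetric bilinear form b, and × a cross product on (V, b). Let C be the F-algebra whose underlying vector space is F × V with product (α, v)·(β, w) = (αβ − b(v,w), α·w + β·v + v×w), and define the norm n : C → F by n(α, v) = α² + b(v, v). Then the norm is multiplicative: n(x·y) = n(x)·n(y) for all x, y ∈ C. -/
/-- The norm of the Cayley algebra `C = F ⊕ V` built from a cross product is multiplicative. -/
theorem cayley_norm_multiplicative
    (F V : Type*) [Field F] [AddCommGroup V] [Module F V]
    (hchar : ringChar F ≠ 2)
    (b : V →ₗ[F] V →ₗ[F] F)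
    (hsymm : ∀ x y : V, b x y = b y x)
    (hnd : ∀ x : V, (∀ y : V, b x y = 0) → x = 0)
    (c : V →ₗ[F] V →ₗ[F] V)
    (h1 : ∀ x y : V, b (c x y) x = 0)
    (h2 : ∀ x : V, c x x = 0)
    (h3 : ∀ x y : V, b (c x y) (c x y) = b x x * b y y - b x y * b y x) :
    ∀ x y : F × V,
      (x.1 * y.1 - b x.2 y.2) ^ 2
        + b (x.1 • y.2 + y.1 • x.2 + c x.2 y.2) (x.1 • y.2 + y.1 • x.2 + c x.2 y.2)
      = (x.1 ^ 2 + b x.2 x.2) * (y.1 ^ 2 + b y.2 y.2) := by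
  rintro ⟨α, v⟩ ⟨β, w⟩
  have hanti : c v w = -c w v := by
    have h := h2 (v + w)
    simp only [map_add, LinearMap.add_apply, h2, zero_add, add_zero] at h
    exact eq_neg_of_add_eq_zero_right h
  have hv : b (c v w) v = 0 := h1 v w
  have hw : b (c v w) w = 0 := by rw [hanti]; simp [h1]
  simp only [map_add, map_smul, LinearMap.add_apply, LinearMap.smul_apply, smul_eq_mul,
    hsymm v (c v w), hsymm w (c v w), hv, hw, h3, hsymm w v]
  ring
end

section
/- Let F be a field with char(F) ≠ 2, V a 3-dimensional F-vector space with a nondegenerate symmetric bilinear form b, and × a cross product on (V, b). Then for all x, y, z ∈ V: (x×y)×z = b(x,z)·y − b(y,z)·x. -/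
/-- A quadrilinear alternating form vanishes on a space of dimension less than four. -/
theorem alternating_four_form_eq_zero {F V : Type*} [Field F] [AddCommGroup V] [Module F V]
    [FiniteDimensional F V] (hdim : Module.finrank F V < 4)
    (Q : V →ₗ[F] V → V → V → F) (hdiag : ∀ x z w, Q x x z w = 0)
    (h12 : ∀ x y z w, Q x y z w = -Q y x z w) (h23 : ∀ x y z w, Q x y z w = -Q x z y w)
    (h34 : ∀ x y z w, Q x y z w = -Q x y w z) (x y z w : V) : Q x y z w = 0 := by
  have hdep : ¬ LinearIndependent F ![x, y, z, w] := fun h => by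
    have := h.fintype_card_le_finrank
    simp only [Fintype.card_fin] at this
    omega
  obtain ⟨g, hg, i, hi⟩ := Fintype.not_linearIndependent_iff.1 hdep
  simp only [Fin.sum_univ_four, Matrix.cons_val] at hg
  have expand (p q r : V) :
      g 0 * Q x p q r + g 1 * Q y p q r + g 2 * Q z p q r + g 3 * Q w p q r = 0 := by
    have := congrFun (congrFun (congrFun (congrArg Q hg) p) q) r
    simpa using this
  have hdiag' (x y w : V) : Q x y x w = 0 := by rw [h23, hdiag, neg_zero]
  have hdiag'' (x y z : V) : Q x y z x = 0 := by rw [h34, hdiag', neg_zero]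
  fin_cases i
  · have := expand y z w
    simp only [hdiag, hdiag', hdiag'', mul_zero, add_zero] at this
    exact (mul_eq_zero.1 this).resolve_left hi
  · have := expand x z w
    simp only [hdiag, hdiag', hdiag'', mul_zero, add_zero, zero_add] at this
    rw [h12, neg_eq_zero]
    exact (mul_eq_zero.1 this).resolve_left hi
  · have := expand x y w
    simp only [hdiag, hdiag', hdiag'', mul_zero, add_zero, zero_add] at this
    rw [h23, h12, neg_neg]
    exact (mul_eq_zero.1 this).resolve_left hi
  · have := expand x y z
    simp only [hdiag, hdiag', hdiag'', mul_zero, add_zero, zero_add] at this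
    rw [h34, h23, h12, neg_neg, neg_eq_zero]
    exact (mul_eq_zero.1 this).resolve_left hi

/-- In dimension 3, a cross product satisfies `(x×y)×z = b(x,z)y − b(y,z)x`. -/
theorem cross_product_dim_three_double
    (F V : Type*) [Field F] [AddCommGroup V] [Module F V]
    (hchar : ringChar F ≠ 2)
    (hdim : Module.finrank F V = 3)
    (b : V →ₗ[F] V →ₗ[F] F)
    (hsymm : ∀ x y : V, b x y = b y x)
    (hnd : ∀ x : V, (∀ y : V, b x y = 0) → x = 0)
    (c : V →ₗ[F] V →ₗ[F] V)
    (h1 : ∀ x y : V, b (c x y) x = 0)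
    (h2 : ∀ x : V, c x x = 0)
    (h3 : ∀ x y : V, b (c x y) (c x y) = b x x * b y y - b x y * b y x) :
    ∀ x y z : V, c (c x y) z = (b x z) • y - (b y z) • x := by
  intro x y z
  have : FiniteDimensional F V := Module.finite_of_finrank_eq_succ hdim
  have h_two : (2 : F) ≠ 0 := Ring.two_ne_zero hchar
  have hskew (x y : V) : c x y = -c y x := by
    have := h2 (x + y)
    simp only [map_add, LinearMap.add_apply, h2, zero_add, add_zero] at this
    exact eq_neg_of_add_eq_zero_right this
  have htriple (x y z : V) : b (c x y) z = -b (c z y) x := by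
    have := h1 (x + z) y
    simp only [map_add, LinearMap.add_apply, h1, zero_add, add_zero] at this
    linear_combination this
  have hnorm (x y z : V) : b (c x y) (c x z) = b x x * b y z - b x y * b x z := by
    have := h3 x (y + z)
    simp only [map_add, LinearMap.add_apply, h3] at this
    refine mul_left_cancel₀ h_two ?_
    rw [hsymm (c x z) (c x y), hsymm z y, hsymm y x, hsymm z x] at this
    linear_combination this
  have hdouble (x y w : V) : b (c (c x y) y) w = b x y * b y w - b y y * b x w := by
    have e : b (c (c x y) y) w = -b (c y w) (c y x) := by
      rw [htriple, hskew w y, hskew x y, map_neg, map_neg, LinearMap.neg_apply, neg_neg]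
    rw [e, hnorm, hsymm w x, hsymm y x]
    ring
  let Q : V →ₗ[F] V → V → V → F :=
    { toFun := fun x y z w => b (c (c x y) z) w - b x z * b y w + b y z * b x w
      map_add' := fun x x' => by
        funext y z w
        simp only [map_add, LinearMap.add_apply, Pi.add_apply]
        ring
      map_smul' := fun r x => by
        funext y z w
        simp only [map_smul, LinearMap.smul_apply, Pi.smul_apply, smul_eq_mul, RingHom.id_apply]
        ring }
  have hQ (x y z w : V) :
      Q x y z w = b (c (c x y) z) w - b x z * b y w + b y z * b x w := rfl
  have hzero (x y z w : V) : Q x y z w = 0 := by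
    refine alternating_four_form_eq_zero (by omega) Q ?_ ?_ ?_ ?_ x y z w <;> intros
    · simp only [hQ, h2, map_zero, LinearMap.zero_apply]
      ring
    · rename_i x y z w
      simp only [hQ]
      rw [hskew x y, map_neg, LinearMap.neg_apply, map_neg, LinearMap.neg_apply]
      ring
    · rename_i x y z w
      have := hdouble x (y + z) w
      simp only [map_add, LinearMap.add_apply, hdouble] at this
      simp only [hQ]
      rw [hsymm z y] at this ⊢
      linear_combination this
    · rename_i x y z w
      simp only [hQ]
      rw [hskew (c x y) z, hskew (c x y) w, map_neg, map_neg, LinearMap.neg_apply,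
        LinearMap.neg_apply, htriple z]
      ring
  refine sub_eq_zero.1 (hnd _ fun w => ?_)
  have := hzero x y z w
  rw [hQ] at this
  simp only [map_sub, LinearMap.sub_apply, map_smul, LinearMap.smul_apply, smul_eq_mul]
  linear_combination this
end

section
/- Let F be a field with char(F) ≠ 2, V a 3-dimensional F-vector space with a nondegenerate symmetric bilinear form b, and × a cross product on (V, b). Then for all x₁, x₂, x₃, y₁, y₂, y₃ ∈ V: b(x₁×x₂, x₃) · b(y₁×y₂, y₃) = det M, where M is the 3×3 matrix with entries M_{ij} = b(x_i, y_j). -/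
/-- The Gram determinant of `b` between two families, in terms of their coordinates in a basis. -/
theorem det_bilin_eq_basis_det {ι F V : Type*} [Fintype ι] [DecidableEq ι] [CommRing F]
    [AddCommGroup V] [Module F V] (b : V →ₗ[F] V →ₗ[F] F) (e : Module.Basis ι F V) (x y : ι → V) :
    Matrix.det (Matrix.of fun i j => b (x i) (y j))
      = e.det x * Matrix.det (Matrix.of fun i j => b (e i) (e j)) * e.det y := by
  have h : (Matrix.of fun i j => b (x i) (y j))
      = (e.toMatrix x).transpose * (Matrix.of fun i j => b (e i) (e j)) * e.toMatrix y := by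
    ext i j
    simp only [Matrix.of_apply]
    conv_lhs => rw [← e.sum_repr (x i), ← e.sum_repr (y j)]
    simp only [map_sum, map_smul, LinearMap.sum_apply, LinearMap.smul_apply, smul_eq_mul,
      Matrix.mul_apply, Matrix.transpose_apply, Module.Basis.toMatrix_apply, Matrix.of_apply,
      Finset.sum_mul, Finset.mul_sum]
    exact Finset.sum_congr rfl fun k _ => Finset.sum_congr rfl fun l _ => by ring
  rw [h, Matrix.det_mul, Matrix.det_mul, Matrix.det_transpose, e.det_apply, e.det_apply]

/-- An alternating product orthogonal to its first factor is orthogonal to its second factor. -/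
theorem bilin_cross_right_eq_zero {F V : Type*} [CommRing F] [AddCommGroup V] [Module F V]
    (b : V →ₗ[F] V →ₗ[F] F) (c : V →ₗ[F] V →ₗ[F] V)
    (h1 : ∀ x y : V, b (c x y) x = 0) (h2 : ∀ x : V, c x x = 0) (x y : V) :
    b (c x y) y = 0 := by
  rw [← LinearMap.IsAlt.neg h2 y x, map_neg, LinearMap.neg_apply, h1, neg_zero]

/-- The triple product `b (x × y) z` of an alternating product orthogonal to its first factor,
as an alternating map. -/
def tripleProduct {F V : Type*} [CommRing F] [AddCommGroup V] [Module F V]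
    (b : V →ₗ[F] V →ₗ[F] F) (c : V →ₗ[F] V →ₗ[F] V)
    (h1 : ∀ x y : V, b (c x y) x = 0) (h2 : ∀ x : V, c x x = 0) : V [⋀^Fin 3]→ₗ[F] F where
  toFun v := b (c (v 0) (v 1)) (v 2)
  map_update_add' := by
    intro inst v i x y
    obtain rfl : inst = instDecidableEqFin 3 := Subsingleton.elim _ _
    fin_cases i <;> simp
  map_update_smul' := by
    intro inst v i a x
    obtain rfl : inst = instDecidableEqFin 3 := Subsingleton.elim _ _
    fin_cases i <;> simp
  map_eq_zero_of_eq' v i j hv hij := by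
    have hright := bilin_cross_right_eq_zero b c h1 h2
    fin_cases i <;> fin_cases j <;> simp_all

/-- In dimension 3, `b(x₁×x₂,x₃)·b(y₁×y₂,y₃) = det (b(xᵢ,yⱼ))`. -/
theorem cross_product_dim_three_det
    (F V : Type*) [Field F] [AddCommGroup V] [Module F V]
    (hchar : ringChar F ≠ 2)
    (hdim : Module.finrank F V = 3)
    (b : V →ₗ[F] V →ₗ[F] F)
    (hsymm : ∀ x y : V, b x y = b y x)
    (hnd : ∀ x : V, (∀ y : V, b x y = 0) → x = 0)
    (c : V →ₗ[F] V →ₗ[F] V)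
    (h1 : ∀ x y : V, b (c x y) x = 0)
    (h2 : ∀ x : V, c x x = 0)
    (h3 : ∀ x y : V, b (c x y) (c x y) = b x x * b y y - b x y * b y x)
    (x y : Fin 3 → V) :
    b (c (x 0) (x 1)) (x 2) * b (c (y 0) (y 1)) (y 2)
      = Matrix.det (Matrix.of fun i j : Fin 3 => b (x i) (y j)) := by
  have hfin : Module.Finite F V := Module.finite_of_finrank_pos (by omega)
  let : Invertible (2 : F) := invertibleOfNonzero (Ring.two_ne_zero hchar)
  obtain ⟨v, hv⟩ := LinearMap.BilinForm.exists_orthogonal_basis (B := b) ⟨hsymm⟩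
  let e : Module.Basis (Fin 3) F V := v.reindex (finCongr hdim)
  have he : LinearMap.IsOrthoᵢ b e := fun i j hij => by
    simpa [e, Function.onFun] using hv fun h => hij ((finCongr hdim.symm).injective h)
  have hself := he.not_isOrtho_basis_self_of_separatingLeft hnd
  let ω := tripleProduct b c h1 h2
  have hω : ∀ z, ω z = ω e * e.det z := fun z => by
    conv_lhs => rw [ω.eq_smul_basis_det e]
    simp
  set u := c (e 0) (e 1)
  have huu : b u u = b (e 0) (e 0) * b (e 1) (e 1) := by
    rw [h3, show b (e 0) (e 1) = 0 from he (by decide), zero_mul, sub_zero]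
  have hu0 : b u (e 0) = 0 := h1 _ _
  have hu1 : b u (e 1) = 0 := bilin_cross_right_eq_zero b c h1 h2 _ _
  have huu0 : b u u ≠ 0 := huu ▸ mul_ne_zero (hself 0) (hself 1)
  have hωu : b u u = ω e * e.det ![e 0, e 1, u] := hω ![e 0, e 1, u]
  have hgram := det_bilin_eq_basis_det b e ![e 0, e 1, u] ![e 0, e 1, u]
  have hgramu : Matrix.det (Matrix.of fun i j : Fin 3 =>
      b (![e 0, e 1, u] i) (![e 0, e 1, u] j)) = b u u * b u u := by
    have h01 : b (e 0) (e 1) = 0 := he (by decide)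
    simp [Matrix.det_fin_three, h01, hsymm (e 1) (e 0), hsymm (e 0) u, hsymm (e 1) u, hu0, hu1,
      huu]
  have hdet : e.det ![e 0, e 1, u] ≠ 0 := right_ne_zero_of_mul (hωu ▸ huu0)
  have hsq : ω e * ω e = Matrix.det (Matrix.of fun i j : Fin 3 => b (e i) (e j)) := by
    refine mul_right_cancel₀ (mul_ne_zero hdet hdet) ?_
    linear_combination hgram - hgramu - (b u u + ω e * e.det ![e 0, e 1, u]) * hωu
  change ω x * ω y = _
  rw [det_bilin_eq_basis_det b e x y, ← hsq, hω x, hω y]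
  ring
end

section
/- Let F be a field of characteristic 0 and V a 3-dimensional F-vector space with a nondegenerate symmetric bilinear form b. For every n ∈ ℕ, an F-linear endomorphism f of V^{⊗n} satisfies f ∘ g^{⊗n} = g^{⊗n} ∘ f for every g ∈ SO(V,b) if and only if it satisfies f ∘ g^{⊗n} = g^{⊗n} ∘ f for every g ∈ O(V,b); that is, End_{SO(V,b)}(V^{⊗n}) = End_{O(V,b)}(V^{⊗n}). -/
/-- Scaling `g` by `c` scales its `ι`-fold tensor power by `c ^ card ι`. -/
theorem PiTensorProduct.map_const_smul {ι R M N : Type*} [Fintype ι] [CommSemiring R]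
    [AddCommMonoid M] [Module R M] [AddCommMonoid N] [Module R N] (c : R) (g : M →ₗ[R] N) :
    PiTensorProduct.map (fun _ : ι => c • g)
      = c ^ Fintype.card ι • PiTensorProduct.map (fun _ : ι => g) := by
  ext x
  simp [MultilinearMap.map_smul_univ]

/-- An isometry of a nondegenerate bilinear form has determinant `1` or `-1`. -/
theorem LinearMap.det_eq_one_or_neg_one_of_isometry {F V : Type*} [Field F] [AddCommGroup V]
    [Module F V] [FiniteDimensional F V] (b : V →ₗ[F] V →ₗ[F] F) (hb : b.SeparatingLeft)
    (g : V →ₗ[F] V) (hg : ∀ x y, b (g x) (g y) = b x y) :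
    LinearMap.det g = 1 ∨ LinearMap.det g = -1 := by
  let e := Module.finBasis F V
  have hM : (LinearMap.toMatrix₂ e e b).det ≠ 0 :=
    (LinearMap.separatingLeft_iff_det_ne_zero e).mp hb
  have hcomp : b.compl₁₂ g g = b := by
    ext x y
    exact hg x y
  have hdet := congrArg Matrix.det (LinearMap.toMatrix₂_compl₁₂ e e e e b g g)
  rw [hcomp, Matrix.det_mul, Matrix.det_mul, Matrix.det_transpose, LinearMap.det_toMatrix] at hdet
  have hsq : LinearMap.det g * LinearMap.det g = 1 := by
    apply mul_left_cancel₀ hM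
    linear_combination -hdet
  exact mul_self_eq_one_iff.mp hsq


/-- For a 3-dimensional space with a nondegenerate symmetric bilinear form in characteristic 0,
an endomorphism of `V^{⊗n}` commutes with `SO(V,b)` iff it commutes with `O(V,b)`. -/
theorem centralizer_SO_eq_centralizer_O
    (F V : Type*) [Field F] [CharZero F] [AddCommGroup V] [Module F V]
    (hdim : Module.finrank F V = 3)
    (b : V →ₗ[F] V →ₗ[F] F)
    (hsymm : ∀ x y : V, b x y = b y x)
    (hnd : ∀ x : V, (∀ y : V, b x y = 0) → x = 0)
    (n : ℕ)
    (f : TensorPower F n V →ₗ[F] TensorPower F n V) :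
    (∀ g : V →ₗ[F] V, Function.Bijective g → (∀ x y : V, b (g x) (g y) = b x y) →
        LinearMap.det g = 1 →
        f ∘ₗ PiTensorProduct.map (fun _ : Fin n => g)
          = PiTensorProduct.map (fun _ : Fin n => g) ∘ₗ f)
    ↔ (∀ g : V →ₗ[F] V, Function.Bijective g → (∀ x y : V, b (g x) (g y) = b x y) →
        f ∘ₗ PiTensorProduct.map (fun _ : Fin n => g)
          = PiTensorProduct.map (fun _ : Fin n => g) ∘ₗ f) := by
  constructor
  · intro h g hbij hg
    have : FiniteDimensional F V := Module.finite_of_finrank_eq_succ hdim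
    rcases LinearMap.det_eq_one_or_neg_one_of_isometry b hnd g hg with hdet | hdet
    · exact h g hbij hg hdet
    · have hneg := h ((-1 : F) • g)
        (by simpa [Function.comp_def, Pi.neg_def] using (Equiv.neg V).bijective.comp hbij)
        (fun x y => by simp [hg]) (by rw [LinearMap.det_smul, hdim, hdet]; norm_num)
      rw [PiTensorProduct.map_const_smul, LinearMap.comp_smul, LinearMap.smul_comp] at hneg
      exact smul_right_injective _ (pow_ne_zero _ (neg_ne_zero.mpr one_ne_zero)) hneg
  · intro h g hbij hg _
    exact h g hbij hg
end
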